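/- Let T be a tree on n vertices with diameter n − t, where 2 ≤ t ≤ n − 3. Then the number of leaves of T satisfies |D_1(T)| ≥ f(n,t), where f(n,t) = ⌈2(t−1)/(n−t)⌉ + 2 if n − t is even, and f(n,t) = ⌈2(t−1)/(n−t−1)⌉ + 2 if n − t is odd. -/

import Mathlib

open SimpleGraph

/-- The degree of a vertex `v` in `G`: the number of neighbors of `v`. -/
noncomputable def degN {V : Type*} (G : SimpleGraph V) (v : V) : ℕ := {u | G.Adj v u}.ncard

/-- A set of vertices is `k`-independent if the induced subgraph has maximum degree at
most `k`, i.e. every vertex of the set has at most `k` neighbors inside the set. -/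
def IsKIndepSet {V : Type*} (G : SimpleGraph V) (k : ℕ) (S : Set V) : Prop :=
  ∀ v ∈ S, {u | u ∈ S ∧ G.Adj v u}.ncard ≤ k

/-- A set of vertices is regular if all its vertices have the same degree in `G`. -/
def IsRegularSet {V : Type*} (G : SimpleGraph V) (S : Set V) : Prop :=
  ∀ u ∈ S, ∀ v ∈ S, degN G u = degN G v

/-- The regular `k`-independence number `α_{k-reg}(G)`: the maximum cardinality of a set
of vertices that is both `k`-independent and regular. -/
noncomputable def regKIndepNum {V : Type*} (G : SimpleGraph V) (k : ℕ) : ℕ :=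
  sSup {m : ℕ | ∃ S : Set V, S.ncard = m ∧ IsKIndepSet G k S ∧ IsRegularSet G S}

/-- `f(n,t) = ⌈2(t-1)/(n-t)⌉ + 2` if `n - t` is even, and
`f(n,t) = ⌈2(t-1)/(n-t-1)⌉ + 2` if `n - t` is odd. -/
def fnt (n t : ℕ) : ℕ :=
  if (n - t) % 2 = 0 then (2 * (t - 1) + (n - t) - 1) / (n - t) + 2
  else (2 * (t - 1) + (n - t - 1) - 1) / (n - t - 1) + 2

namespace SimpleGraph

variable {V : Type*} {G : SimpleGraph V} {u v c x a b : V}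

/-- On a geodesic there is a vertex at every intermediate distance. -/
lemma Connected.exists_dist_eq_and_add_eq (hG : G.Connected) {k : ℕ} (hk : k ≤ G.dist u v) :
    ∃ c, G.dist u c = k ∧ G.dist u c + G.dist c v = G.dist u v := by
  obtain ⟨p, hp⟩ := hG.exists_walk_length_eq_dist u v
  have h₁ := dist_le (p.take k)
  have h₂ := dist_le (p.drop k)
  have h₃ := hG.dist_triangle (u := u) (v := p.getVert k) (w := v)
  rw [Walk.take_length] at h₁
  rw [Walk.drop_length] at h₂
  exact ⟨p.getVert k, by omega, by omega⟩

lemma Walk.dist_add_dist_of_mem_support (hG : G.Connected) {p : G.Walk u v}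
    (hp : p.length = G.dist u v) (hc : c ∈ p.support) :
    G.dist u c + G.dist c v = G.dist u v := by
  classical
  have h := congrArg Walk.length (p.take_spec hc)
  rw [Walk.length_append] at h
  have h₁ := dist_le (p.takeUntil c hc)
  have h₂ := dist_le (p.dropUntil c hc)
  have h₃ := hG.dist_triangle (u := u) (v := c) (w := v)
  omega

lemma Connected.exists_isPath_of_dist_add_dist (hG : G.Connected)
    (h : G.dist u c + G.dist c v = G.dist u v) :
    ∃ p : G.Walk u v, p.IsPath ∧ p.getVert (G.dist u c) = c := by
  obtain ⟨p, hp⟩ := hG.exists_walk_length_eq_dist u c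
  obtain ⟨q, hq⟩ := hG.exists_walk_length_eq_dist c v
  refine ⟨p.append q, Walk.isPath_of_length_eq_dist _ ?_, ?_⟩
  · rw [Walk.length_append]; omega
  · simp [Walk.getVert_append, hp]

/-- A vertex on a geodesic of a tree is determined by its distance to an endpoint. -/
lemma IsTree.eq_of_dist_add_dist (hG : G.IsTree)
    (hc : G.dist u c + G.dist c v = G.dist u v) (hx : G.dist u x + G.dist x v = G.dist u v)
    (h : G.dist u c = G.dist u x) : c = x := by
  obtain ⟨p, hp, hpc⟩ := hG.connected.exists_isPath_of_dist_add_dist hc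
  obtain ⟨q, hq, hqx⟩ := hG.connected.exists_isPath_of_dist_add_dist hx
  have := hG.isAcyclic.subsingleton_path u v
  obtain rfl : p = q :=
    congrArg Subtype.val (Subsingleton.elim (⟨p, hp⟩ : G.Path u v) ⟨q, hq⟩)
  rw [← hpc, h, hqx]

/-- If `c` separates `u` from `v` in a tree, it separates any `x` from one of them. -/
lemma IsTree.dist_add_dist_or (hG : G.IsTree) (hc : G.dist u c + G.dist c v = G.dist u v) (x : V) :
    G.dist u c + G.dist c x = G.dist u x ∨ G.dist x c + G.dist c v = G.dist x v := by
  classical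
  obtain ⟨p, hp⟩ := hG.connected.exists_walk_length_eq_dist u x
  obtain ⟨q, hq⟩ := hG.connected.exists_walk_length_eq_dist x v
  obtain ⟨s, hs, hsc⟩ := hG.connected.exists_isPath_of_dist_add_dist hc
  have := hG.isAcyclic.subsingleton_path u v
  have hb : (p.append q).bypass = s :=
    congrArg Subtype.val
      (Subsingleton.elim (⟨_, (p.append q).bypass_isPath⟩ : G.Path u v) ⟨s, hs⟩)
  have hmem : c ∈ (p.append q).support :=
    (p.append q).support_bypass_subset_support (hb ▸ hsc ▸ s.getVert_mem_support _)
  rcases (Walk.mem_support_append_iff _ _).1 hmem with h | h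
  · exact .inl (Walk.dist_add_dist_of_mem_support hG.connected hp h)
  · exact .inr (Walk.dist_add_dist_of_mem_support hG.connected hq h)

/-- A finite tree has a central vertex or a central edge, according to the parity of its
diameter. -/
lemma IsTree.exists_center [Finite V] (hG : G.IsTree) :
    ∃ a b, G.dist a b = G.diam % 2 ∧
      ∀ x, min (G.dist a x) (G.dist b x) ≤ G.diam / 2 := by
  have := hG.connected.nonempty
  have hG' := hG.connected
  have hle : ∀ x y, G.dist x y ≤ G.diam := fun x y ↦
    dist_le_diam (connected_iff_ediam_ne_top.1 hG')
  obtain ⟨u, v, huv⟩ := G.exists_dist_eq_diam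
  obtain ⟨a, ha, hav⟩ := hG'.exists_dist_eq_and_add_eq (u := u) (v := v) (k := G.diam / 2)
    (by omega)
  obtain ⟨b, hb, hbv⟩ := hG'.exists_dist_eq_and_add_eq (u := a) (v := v) (k := G.diam % 2)
    (by omega)
  have hub : G.dist u b + G.dist b v = G.dist u v := by
    have h₁ := hG'.dist_triangle (u := u) (v := a) (w := b)
    have h₂ := hG'.dist_triangle (u := u) (v := b) (w := v)
    omega
  refine ⟨a, b, hb, fun x ↦ ?_⟩
  have hux := hle u x
  have hxv := hle x v
  rw [G.dist_comm (u := a) (v := x), G.dist_comm (u := b) (v := x)]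
  have h₁ := hG.dist_add_dist_or hav x
  have h₂ := hG.dist_add_dist_or hub x
  rw [G.dist_comm (u := a) (v := x)] at h₁
  rw [G.dist_comm (u := b) (v := x)] at h₂
  have h₃ : G.diam % 2 = 1 → G.dist x a ≠ G.dist x b := fun h ↦
    hG.dist_ne_of_adj x (dist_eq_one_iff_adj.1 (hb.trans h))
  omega

/-- In a tree, a vertex `x ∉ {a, b}`, with `a` and `b` equal or adjacent and `a` not farther
from `x` than `b`, has a neighbor such that all others are farther from both `a` and `b`. -/
lemma IsTree.exists_adj_forall_adj (hG : G.IsTree) (hab : G.dist a b ≤ 1) (hxa : x ≠ a)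
    (hle : G.dist a x ≤ G.dist b x) :
    ∃ w, G.Adj x w ∧ ∀ y, G.Adj x y → y ≠ w →
      G.dist a y = G.dist a x + 1 ∧ G.dist b y = G.dist b x + 1 := by
  have hG' := hG.connected
  have hpos := hG'.pos_dist_of_ne hxa.symm
  obtain ⟨w, hw, hwx⟩ := hG'.exists_dist_eq_and_add_eq (u := a) (v := x) (k := G.dist a x - 1)
    (by omega)
  have hadj : G.Adj w x := dist_eq_one_iff_adj.1 (by omega)
  have h₁ := dist_eq_one_iff_adj.2 hadj
  have hbw : G.dist b w + 1 = G.dist b x := by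
    have h₂ := hG'.dist_triangle (u := b) (v := a) (w := w)
    rw [G.dist_comm (u := b) (v := a)] at h₂
    have h₃ := hG.dist_eq_dist_add_one_of_adj b hadj
    have h₄ : G.dist a b = 1 → G.dist a x ≠ G.dist b x := fun h ↦ by
      rw [G.dist_comm (u := a) (v := x), G.dist_comm (u := b) (v := x)]
      exact hG.dist_ne_of_adj x (dist_eq_one_iff_adj.1 h)
    omega
  refine ⟨w, hadj.symm, fun y hy hyw ↦ ?_⟩
  have h₅ := dist_eq_one_iff_adj.2 hy.symm
  constructor
  · refine (hG.dist_eq_dist_add_one_of_adj a hy).resolve_left fun h ↦ hyw ?_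
    exact hG.eq_of_dist_add_dist (u := a) (v := x) (by omega) (by omega) (by omega)
  · refine (hG.dist_eq_dist_add_one_of_adj b hy).resolve_left fun h ↦ hyw ?_
    exact hG.eq_of_dist_add_dist (u := b) (v := x) (by omega) (by omega) (by omega)

/-- In a finite tree, every vertex outside `{a, b}` lies between `{a, b}` and a leaf. -/
lemma IsTree.exists_leaf_min_dist_eq [Finite V] (hG : G.IsTree) (hab : G.dist a b ≤ 1)
    (hxa : x ≠ a) (hxb : x ≠ b) :
    ∃ l, degN G l = 1 ∧
      min (G.dist a l) (G.dist b l) = min (G.dist a x) (G.dist b x) + G.dist x l := by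
  have hG' := hG.connected
  obtain ⟨l, hl, hmax⟩ := Set.exists_max_image
    {l | min (G.dist a l) (G.dist b l) = min (G.dist a x) (G.dist b x) + G.dist x l}
    (G.dist x) (Set.toFinite _) ⟨x, by simp⟩
  simp only [Set.mem_ofPred_eq] at hl hmax
  refine ⟨l, ?_, hl⟩
  have hpa := hG'.pos_dist_of_ne hxa.symm
  have hpb := hG'.pos_dist_of_ne hxb.symm
  have hla : l ≠ a := by rintro rfl; simp at hl; omega
  have hlb : l ≠ b := by rintro rfl; simp at hl; omega
  obtain ⟨w, hw, hwy⟩ : ∃ w, G.Adj l w ∧ ∀ y, G.Adj l y → y ≠ w →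
      G.dist a y = G.dist a l + 1 ∧ G.dist b y = G.dist b l + 1 := by
    rcases le_total (G.dist a l) (G.dist b l) with h | h
    · exact hG.exists_adj_forall_adj hab hla h
    · obtain ⟨w, hw, hwy⟩ := hG.exists_adj_forall_adj (by rwa [G.dist_comm]) hlb h
      exact ⟨w, hw, fun y hy hne ↦ (hwy y hy hne).symm⟩
  rw [degN, Set.ncard_eq_one]
  refine ⟨w, Set.ext fun y ↦ ⟨fun hy ↦ ?_, fun hy ↦ hy ▸ hw⟩⟩
  by_contra hne
  obtain ⟨h₁, h₂⟩ := hwy y hy hne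
  have h₃ := hG'.dist_triangle (u := x) (v := l) (w := y)
  have h₄ := hG'.dist_triangle (u := a) (v := x) (w := y)
  have h₅ := hG'.dist_triangle (u := b) (v := x) (w := y)
  have h₆ := dist_eq_one_iff_adj.2 hy
  have h₇ := hmax y (by omega)
  omega

/-- Each leaf of a finite tree accounts for at most `diam / 2` vertices off the center. -/
lemma IsTree.card_le_ncard_leaves_mul [Fintype V] (hG : G.IsTree) :
    Fintype.card V ≤ {v | degN G v = 1}.ncard * (G.diam / 2) + 1 + G.diam % 2 := by
  classical
  have hG' := hG.connected
  obtain ⟨a, b, hab, hmin⟩ := hG.exists_center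
  have hab' : G.dist a b ≤ 1 := by omega
  choose! l hl hlx using fun (x : V) (hx : x ≠ a ∧ x ≠ b) ↦
    hG.exists_leaf_min_dist_eq hab' hx.1 hx.2
  have hcard : ((Finset.univ : Finset V) \ {a, b}).card ≤
      ({v | degN G v = 1}.toFinset ×ˢ Finset.Icc 1 (G.diam / 2)).card := by
    refine Finset.card_le_card_of_injOn
      (fun x ↦ (l x, min (G.dist a x) (G.dist b x))) (fun x hx ↦ ?_) (fun x hx y hy hxy ↦ ?_)
    · have hx' : x ≠ a ∧ x ≠ b := by simpa using hx
      have hpa := hG'.pos_dist_of_ne hx'.1.symm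
      have hpb := hG'.pos_dist_of_ne hx'.2.symm
      have := hmin x
      simp only [Finset.coe_product, Set.mem_prod, Finset.mem_coe, Set.mem_toFinset,
        Finset.mem_Icc, Set.mem_ofPred_eq]
      exact ⟨hl x hx', by omega, this⟩
    · have hx' : x ≠ a ∧ x ≠ b := by simpa using hx
      have hy' : y ≠ a ∧ y ≠ b := by simpa using hy
      obtain ⟨h₁, h₂⟩ := Prod.mk.inj hxy
      have hx₁ := hlx x hx'
      have hy₁ := hlx y hy'
      rw [← h₁] at hy₁
      have hax := hG'.dist_triangle (u := a) (v := x) (w := l x)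
      have hbx := hG'.dist_triangle (u := b) (v := x) (w := l x)
      have hay := hG'.dist_triangle (u := a) (v := y) (w := l x)
      have hby := hG'.dist_triangle (u := b) (v := y) (w := l x)
      rcases Nat.le_one_iff_eq_zero_or_eq_one.1 hab' with h | h
      · obtain rfl := hG'.dist_eq_zero_iff.1 h
        exact hG.eq_of_dist_add_dist (u := a) (v := l x) (by omega) (by omega) (by omega)
      · have hne : G.dist a (l x) ≠ G.dist b (l x) := by
          rw [G.dist_comm (u := a), G.dist_comm (u := b)]
          exact hG.dist_ne_of_adj (l x) (dist_eq_one_iff_adj.1 h)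
        rcases le_total (G.dist a (l x)) (G.dist b (l x)) with hle | hle
        · exact hG.eq_of_dist_add_dist (u := a) (v := l x) (by omega) (by omega) (by omega)
        · exact hG.eq_of_dist_add_dist (u := b) (v := l x) (by omega) (by omega) (by omega)
  rw [Finset.card_product, Nat.card_Icc, ← Set.ncard_eq_toFinset_card', Nat.add_sub_cancel]
    at hcard
  have hpair : ({a, b} : Finset V).card ≤ 1 + G.diam % 2 := by
    rcases Nat.le_one_iff_eq_zero_or_eq_one.1 hab' with h | h
    · obtain rfl := hG'.dist_eq_zero_iff.1 h
      simp
    · rw [← hab, h]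
      exact Finset.card_le_two
  have := Finset.le_card_sdiff ({a, b} : Finset V) Finset.univ
  rw [Finset.card_univ] at this
  omega

end SimpleGraph

/-- For a tree `T` on `n` vertices with diameter `n - t`, where `2 ≤ t ≤ n - 3`, the
number of leaves of `T` is at least `f(n,t)`. -/
theorem stmt_8 {V : Type*} [Fintype V] (T : SimpleGraph V) (hT : T.IsTree)
    (n t : ℕ) (hn : Fintype.card V = n) (ht2 : 2 ≤ t) (ht3 : t ≤ n - 3)
    (hdiam : T.diam = n - t) :
    fnt n t ≤ {v : V | degN T v = 1}.ncard := by
  have hcard := hT.card_le_ncard_leaves_mul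
  rw [hdiam, hn] at hcard
  unfold fnt
  obtain ⟨d, hd⟩ : ∃ d, d = n - t := ⟨_, rfl⟩
  obtain ⟨L, hL⟩ : ∃ L, L = {v : V | degN T v = 1}.ncard := ⟨_, rfl⟩
  rw [← hd, ← hL] at hcard ⊢
  have hL2 : 2 ≤ L := by
    by_contra! h
    have : L * (d / 2) ≤ 1 * (d / 2) := Nat.mul_le_mul_right _ (by omega)
    omega
  obtain ⟨m, rfl⟩ := Nat.exists_eq_add_of_le' hL2
  obtain ⟨r, hr⟩ : ∃ r, r = d / 2 := ⟨_, rfl⟩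
  rw [← hr, add_mul] at hcard
  split_ifs with h
  · rw [add_le_add_iff_right, ← Nat.lt_succ_iff, Nat.div_lt_iff_lt_mul (by omega)]
    obtain rfl : d = 2 * r := by omega
    have : m.succ * (2 * r) = 2 * (m * r) + 2 * r := by rw [Nat.succ_eq_add_one]; ring
    omega
  · rw [add_le_add_iff_right, ← Nat.lt_succ_iff, Nat.div_lt_iff_lt_mul (by omega)]
    obtain rfl : d = 2 * r + 1 := by omega
    rw [Nat.add_sub_cancel]
    have : m.succ * (2 * r) = 2 * (m * r) + 2 * r := by rw [Nat.succ_eq_add_one]; ring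
    omega
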